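/- There exist no FS-frame W and surjective FS-morphisms p₁ : W → X and p₂ : W → Y such that f ∘ p₁ = g ∘ p₂. In other words, the co-V-formation (Z, X, Y, f, g) has no co-amalgam in the class of FS-frames. -/

import Mathlib

/-- An FS-frame: a poset (le) with a binary relation R satisfying the
Fischer-Servi confluence conditions F1 and F2. -/
structure IsFSFrame {α : Type*} (le R : α → α → Prop) : Prop where
  refl : ∀ a, le a a
  trans : ∀ a b c, le a b → le b c → le a c
  antisymm : ∀ a b, le a b → le b a → a = b
  F1 : ∀ x x' y, le x x' → R x y → ∃ y', R x' y' ∧ le y y'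
  F2 : ∀ x y y', R x y → le y y' → ∃ x', le x x' ∧ R x' y'

/-- An FS-morphism between FS-frames. -/
structure IsFSMorphism {α β : Type*} (leX RX : α → α → Prop)
    (leY RY : β → β → Prop) (f : α → β) : Prop where
  mono : ∀ a b, leX a b → leY (f a) (f b)
  le_back : ∀ a z, leY (f a) z → ∃ a', leX a a' ∧ f a' = z
  forth : ∀ a b, RX a b → RY (f a) (f b)
  weak_back : ∀ a z, RY (f a) z → ∃ a', RX a a' ∧ leY z (f a')
  strong_back : ∀ a m z, leY (f a) m → RY m z →
    ∃ a' a'', leX a a' ∧ RX a' a'' ∧ leY (f a'') z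


/-- The underlying set of the frame X. -/
inductive XF : Type
  | x0 | x1 | x2 | a0 | a1 | a2 | a3 | a4
deriving DecidableEq

/-- The partial order on X generated by x0 ≤ x2, x0 ≤ a3, x0 ≤ a4, x1 ≤ a0,
x1 ≤ a2, together with reflexivity (transitivity adds nothing new). -/
def Xle : XF → XF → Prop := fun a b => a = b ∨
  (a = .x0 ∧ (b = .x2 ∨ b = .a3 ∨ b = .a4)) ∨
  (a = .x1 ∧ (b = .a0 ∨ b = .a2))

/-- The relation R on X. -/
def XR : XF → XF → Prop := fun a b =>
  (a = .x0 ∧ b = .x1) ∨ (a = .x2 ∧ b = .a0) ∨ (a = .x2 ∧ b = .a1) ∨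
  (a = .a3 ∧ b = .a0) ∨ (a = .a4 ∧ b = .a2)

/-- The underlying set of the frame Y. -/
inductive YF : Type
  | y0 | y1 | y2 | b0 | b1 | b2 | b3 | b4
deriving DecidableEq

/-- The partial order on Y generated by y0 ≤ y2, y0 ≤ b3, y0 ≤ b4, y1 ≤ b0,
y1 ≤ b2, together with reflexivity. -/
def Yle : YF → YF → Prop := fun a b => a = b ∨
  (a = .y0 ∧ (b = .y2 ∨ b = .b3 ∨ b = .b4)) ∨
  (a = .y1 ∧ (b = .b0 ∨ b = .b2))

/-- The relation R on Y. -/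
def YR : YF → YF → Prop := fun a b =>
  (a = .y0 ∧ b = .y1) ∨ (a = .y2 ∧ b = .b1) ∨ (a = .y2 ∧ b = .b2) ∨
  (a = .b3 ∧ b = .b0) ∨ (a = .b4 ∧ b = .b2)

/-- The underlying set of the frame Z. -/
inductive ZF : Type
  | z0 | z1 | z2 | k0 | k2 | k3 | k4
deriving DecidableEq

/-- The partial order on Z generated by z0 ≤ z2, z0 ≤ k3, z0 ≤ k4, z1 ≤ k0,
z1 ≤ k2, together with reflexivity. -/
def Zle : ZF → ZF → Prop := fun a b => a = b ∨
  (a = .z0 ∧ (b = .z2 ∨ b = .k3 ∨ b = .k4)) ∨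
  (a = .z1 ∧ (b = .k0 ∨ b = .k2))

/-- The relation R on Z. -/
def ZR : ZF → ZF → Prop := fun a b =>
  (a = .z0 ∧ b = .z1) ∨ (a = .z2 ∧ b = .k0) ∨ (a = .z2 ∧ b = .k2) ∨
  (a = .k3 ∧ b = .k0) ∨ (a = .k4 ∧ b = .k2)

/-- The map f : X → Z. -/
def fXZ : XF → ZF
  | .x0 => .z0
  | .x1 => .z1
  | .x2 => .z2
  | .a0 => .k0
  | .a1 => .k2
  | .a2 => .k2
  | .a3 => .k3
  | .a4 => .k4

/-- The map g : Y → Z. -/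
def gYZ : YF → ZF
  | .y0 => .z0
  | .y1 => .z1
  | .y2 => .z2
  | .b0 => .k0
  | .b1 => .k0
  | .b2 => .k2
  | .b3 => .k3
  | .b4 => .k4


/-- the co-V-formation (Z, X, Y, f, g) has no co-amalgam in the
class of FS-frames: there is no FS-frame W with surjective FS-morphisms
p₁ : W → X and p₂ : W → Y such that f ∘ p₁ = g ∘ p₂. -/
theorem no_coamalgam :
    ∀ (W : Type u) (leW RW : W → W → Prop) (p₁ : W → XF) (p₂ : W → YF),
      IsFSFrame leW RW →
      IsFSMorphism leW RW Xle XR p₁ → IsFSMorphism leW RW Yle YR p₂ →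
      Function.Surjective p₁ → Function.Surjective p₂ →
      fXZ ∘ p₁ = gYZ ∘ p₂ → False := by
  intro W leW RW p₁ p₂ hW h₁ h₂ hs₁ _ hfg
  have fiber : ∀ w, fXZ (p₁ w) = gYZ (p₂ w) := congrFun hfg
  obtain ⟨w, hw⟩ := hs₁ .x0
  obtain ⟨v, hwv, -⟩ := h₁.weak_back w .x1 (by simp [XR, hw])
  obtain ⟨w', hww', hw'⟩ := h₁.le_back w .x2 (by simp [Xle, hw])
  obtain ⟨v', hwv', hvv'⟩ := hW.F1 w w' v hww' hwv
  have hy : p₂ w = .y0 := by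
    have := fiber w
    cases h : p₂ w <;> simp_all [fXZ, gYZ]
  have hy' : p₂ w' = .y2 := by
    have := fiber w'
    cases h : p₂ w' <;> simp_all [fXZ, gYZ]
  have hv : p₁ v = .x1 := by simpa [XR, hw] using h₁.forth w v hwv
  have hu : p₂ v = .y1 := by simpa [YR, hy] using h₂.forth w v hwv
  have hv' : p₁ v' = .a0 := by
    have hR := h₁.forth w' v' hwv'
    have hle := h₁.mono v v' hvv'
    cases h : p₁ v' <;> simp_all [XR, Xle]
  have hu' : p₂ v' = .b2 := by
    have hR := h₂.forth w' v' hwv'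
    have hle := h₂.mono v v' hvv'
    cases h : p₂ v' <;> simp_all [YR, Yle]
  have := fiber v'
  simp [hv', hu', fXZ, gYZ] at this
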